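/- (Creation/raising operator.) Let n ≥ 2 be an integer and i ∈ {1,2}. For every real x at which all rational functions appearing are defined, Θ̃_n(x) · 𝒟_i Q_{n−1}^{(i)}(x) + Λ_{1,n}^{(2)}(x) · Q_{n−1}^{(i)}(x) = Λ_{2,n}^{(2)}(x) · Q_n^{(i)}(x). -/

import Mathlib

open Finset Filter Topology Polynomial

noncomputable section

/-- Pochhammer symbol `(a)_k = a(a+1)⋯(a+k−1)`. -/
def poch (a : ℝ) (k : ℕ) : ℝ := ∏ m ∈ Finset.range k, (a + m)

/-- Falling factorial `[x]_k = x(x−1)⋯(x−k+1)`. -/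
def fall (x : ℝ) (k : ℕ) : ℝ := ∏ m ∈ Finset.range k, (x - m)

/-- `⟨x⟩_i^k`: falling factorial for `i = 1`, Pochhammer symbol for `i = 2`. -/
def br (i : ℕ) (x : ℝ) (k : ℕ) : ℝ := if i = 1 then fall x k else poch x k

/-- Forward (`i = 1`) resp. backward (`i = 2`) difference operator `𝒟_i`. -/
def Dop (i : ℕ) (f : ℝ → ℝ) : ℝ → ℝ :=
  fun x => if i = 1 then f (x + 1) - f x else f x - f (x - 1)

/-- Iterated difference operator `𝒟_i^k`. -/
def Dk (i k : ℕ) (f : ℝ → ℝ) : ℝ → ℝ := (Dop i)^[k] f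

/-- Kronecker delta `δ_{i,m}` (real valued). -/
def kdelta (i m : ℕ) : ℝ := if i = m then 1 else 0

/-- The shift `x ± 1`: `x + 1` for `i = 1`, `x - 1` for `i = 2`. -/
def sh (i : ℕ) (x : ℝ) : ℝ := if i = 1 then x + 1 else x - 1

/-- Monic Meixner polynomial `M_n(x)`. -/
def MeixnerM (γ μ : ℝ) (n : ℕ) (x : ℝ) : ℝ :=
  poch γ n * (μ / (μ - 1)) ^ n *
    ∑ k ∈ Finset.range (n + 1),
      poch (-(n : ℝ)) k * poch (-x) k / poch γ k * (1 - μ⁻¹) ^ k / (Nat.factorial k : ℝ)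

/-- Meixner inner product `⟨p,q⟩ = ∑_{x≥0} p(x)q(x) μ^x (γ)_x / x!`. -/
def mIP (γ μ : ℝ) (p q : ℝ → ℝ) : ℝ :=
  ∑' x : ℕ, p x * q x * μ ^ x * poch γ x / (Nat.factorial x : ℝ)

/-- Squared Meixner norm `‖M_n‖²`. -/
def nrm2 (γ μ : ℝ) (n : ℕ) : ℝ := mIP γ μ (MeixnerM γ μ n) (MeixnerM γ μ n)

/-- Kernel `K_n^{(l,m)}(x,y)` for the operator `𝒟_i`. -/
def Klm (γ μ : ℝ) (i l m n : ℕ) (x y : ℝ) : ℝ :=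
  ∑ k ∈ Finset.range (n + 1),
    Dk i l (MeixnerM γ μ k) x * Dk i m (MeixnerM γ μ k) y / nrm2 γ μ k

/-- Sobolev inner product `⟨p,q⟩_λ = ⟨p,q⟩ + λ 𝒟_i^j p(α) 𝒟_i^j q(α)`. -/
def sIP (γ μ lam α : ℝ) (i j : ℕ) (p q : ℝ → ℝ) : ℝ :=
  mIP γ μ p q + lam * Dk i j p α * Dk i j q α

/-- `Q` is the monic Sobolev orthogonal polynomial of degree `n`. -/
def IsSobolevOP (γ μ lam α : ℝ) (i j n : ℕ) (Q : Polynomial ℝ) : Prop :=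
  Q.Monic ∧ Q.natDegree = n ∧
    ∀ p : Polynomial ℝ, p.degree < (n : WithBot ℕ) →
      sIP γ μ lam α i j (fun x => Q.eval x) (fun x => p.eval x) = 0

/-- Coefficient `a_n^{(k)}`. -/
def acoef (γ μ lam α : ℝ) (i j n k : ℕ) : ℝ :=
  -(lam * (Nat.factorial j : ℝ) * Dk i j (MeixnerM γ μ n) α * Dk i k (MeixnerM γ μ (n - 1)) α) /
    ((Nat.factorial k : ℝ) * nrm2 γ μ (n - 1) * (1 + lam * Klm γ μ i j j (n - 1) α α))

/-- Coefficient `b_n^{(k)}`. -/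
def bcoef (γ μ lam α : ℝ) (i j n k : ℕ) : ℝ :=
  lam * (Nat.factorial j : ℝ) * Dk i j (MeixnerM γ μ n) α * Dk i k (MeixnerM γ μ n) α /
    ((Nat.factorial k : ℝ) * nrm2 γ μ (n - 1) * (1 + lam * Klm γ μ i j j (n - 1) α α))

/-- Rational function `A_{1,n}(x)`. -/
def A1 (γ μ lam α : ℝ) (i j n : ℕ) (x : ℝ) : ℝ :=
  1 + (1 / br i (x - α) (j + 1)) *
    ∑ k ∈ Finset.range (j + 1), acoef γ μ lam α i j n k * br i (x - α) k

/-- Rational function `B_{1,n}(x)`. -/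
def B1 (γ μ lam α : ℝ) (i j n : ℕ) (x : ℝ) : ℝ :=
  (1 / br i (x - α) (j + 1)) *
    ∑ k ∈ Finset.range (j + 1), bcoef γ μ lam α i j n k * br i (x - α) k

/-- Meixner recurrence coefficient `α_n`. -/
def alphaR (γ μ : ℝ) (n : ℕ) : ℝ := ((n : ℝ) * (1 + μ) + μ * γ) / (1 - μ)

/-- Meixner recurrence coefficient `β_n`. -/
def betaR (γ μ : ℝ) (n : ℕ) : ℝ := (n : ℝ) * μ * ((n : ℝ) + γ - 1) / (1 - μ) ^ 2

/-- Rational function `A_{2,n}(x)`. -/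
def A2 (γ μ lam α : ℝ) (i j n : ℕ) (x : ℝ) : ℝ :=
  -(B1 γ μ lam α i j (n - 1) x) / betaR γ μ (n - 1)

/-- Rational function `B_{2,n}(x)`. -/
def B2 (γ μ lam α : ℝ) (i j n : ℕ) (x : ℝ) : ℝ :=
  A1 γ μ lam α i j (n - 1) x + A2 γ μ lam α i j n x * (alphaR γ μ (n - 1) - x)

/-- Rational function `C_{1,n}(x)`. -/
def C1 (γ μ lam α : ℝ) (i j n : ℕ) (x : ℝ) : ℝ :=
  (x + γ * kdelta i 1) * Dop i (A1 γ μ lam α i j n) x + (n : ℝ) * A1 γ μ lam α i j n (sh i x)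
    - ((n : ℝ) - 1) * ((n : ℝ) + γ - 2) * μ ^ kdelta i 2 * B1 γ μ lam α i j n (sh i x) /
        (betaR γ μ (n - 1) * (1 - μ))

/-- Rational function `D_{1,n}(x)`. -/
def D1 (γ μ lam α : ℝ) (i j n : ℕ) (x : ℝ) : ℝ :=
  (x + γ * kdelta i 1) * Dop i (B1 γ μ lam α i j n) x
    + ((n : ℝ) - 1) * B1 γ μ lam α i j n (sh i x)
    + ((n : ℝ) - 1) * ((n : ℝ) + γ - 2) * (x - alphaR γ μ (n - 1)) * μ ^ kdelta i 2 *
        B1 γ μ lam α i j n (sh i x) / (betaR γ μ (n - 1) * (1 - μ))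
    + (n : ℝ) * ((n : ℝ) + γ - 1) * μ ^ kdelta i 2 * A1 γ μ lam α i j n (sh i x) / (1 - μ)

/-- Rational function `C_{2,n}(x)`. -/
def C2 (γ μ lam α : ℝ) (i j n : ℕ) (x : ℝ) : ℝ :=
  -(D1 γ μ lam α i j (n - 1) x) / betaR γ μ (n - 1)

/-- Rational function `D_{2,n}(x)`. -/
def D2 (γ μ lam α : ℝ) (i j n : ℕ) (x : ℝ) : ℝ :=
  C1 γ μ lam α i j (n - 1) x + C2 γ μ lam α i j n x * (alphaR γ μ (n - 1) - x)

/-- `A_{m,n}(x)` for `m = 1, 2`. -/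
def Aa (γ μ lam α : ℝ) (i j n m : ℕ) (x : ℝ) : ℝ :=
  if m = 1 then A1 γ μ lam α i j n x else A2 γ μ lam α i j n x

/-- `B_{m,n}(x)` for `m = 1, 2`. -/
def Bb (γ μ lam α : ℝ) (i j n m : ℕ) (x : ℝ) : ℝ :=
  if m = 1 then B1 γ μ lam α i j n x else B2 γ μ lam α i j n x

/-- `C_{k,n}(x)` for `k = 1, 2`. -/
def Cc (γ μ lam α : ℝ) (i j n k : ℕ) (x : ℝ) : ℝ :=
  if k = 1 then C1 γ μ lam α i j n x else C2 γ μ lam α i j n x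

/-- `D_{k,n}(x)` for `k = 1, 2`. -/
def Dd (γ μ lam α : ℝ) (i j n k : ℕ) (x : ℝ) : ℝ :=
  if k = 1 then D1 γ μ lam α i j n x else D2 γ μ lam α i j n x

/-- `Λ_{m,n}^{(k)}(x) = (−1)^k (C_{k,n}(x) B_{m,n}(x) − A_{m,n}(x) D_{k,n}(x))`. -/
def Lam (γ μ lam α : ℝ) (i j n m k : ℕ) (x : ℝ) : ℝ :=
  (-1 : ℝ) ^ k * (Cc γ μ lam α i j n k x * Bb γ μ lam α i j n m x
    - Aa γ μ lam α i j n m x * Dd γ μ lam α i j n k x)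

/-- `Θ_n(x) = A_{1,n}(x) B_{2,n}(x) − B_{1,n}(x) A_{2,n}(x)`. -/
def Theta (γ μ lam α : ℝ) (i j n : ℕ) (x : ℝ) : ℝ :=
  A1 γ μ lam α i j n x * B2 γ μ lam α i j n x - B1 γ μ lam α i j n x * A2 γ μ lam α i j n x

/-- `Θ̃_n(x) = (x + γ δ_{i,1}) Θ_n(x)`. -/
def Thetatil (γ μ lam α : ℝ) (i j n : ℕ) (x : ℝ) : ℝ :=
  (x + γ * kdelta i 1) * Theta γ μ lam α i j n x

/-! ### Meixner polynomials as elements of `ℝ[X]` -/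

/-- The monic Meixner polynomials, defined by their three-term recurrence. -/
def meixnerPoly (γ μ : ℝ) : ℕ → ℝ[X]
  | 0 => 1
  | 1 => X - C (alphaR γ μ 0)
  | n + 2 => (X - C (alphaR γ μ (n + 1))) * meixnerPoly γ μ (n + 1)
      - C (betaR γ μ (n + 1)) * meixnerPoly γ μ n

lemma X_mul_meixnerPoly_zero (γ μ : ℝ) :
    X * meixnerPoly γ μ 0 = meixnerPoly γ μ 1 + C (alphaR γ μ 0) * meixnerPoly γ μ 0 := by
  simp [meixnerPoly]

lemma X_mul_meixnerPoly_succ (γ μ : ℝ) (n : ℕ) :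
    X * meixnerPoly γ μ (n + 1) = meixnerPoly γ μ (n + 2)
      + C (alphaR γ μ (n + 1)) * meixnerPoly γ μ (n + 1)
      + C (betaR γ μ (n + 1)) * meixnerPoly γ μ n := by
  simp only [meixnerPoly]
  ring

lemma monic_natDegree_meixnerPoly (γ μ : ℝ) (n : ℕ) :
    (meixnerPoly γ μ n).Monic ∧ (meixnerPoly γ μ n).natDegree = n := by
  induction n using Nat.twoStepInduction with
  | zero => simp [meixnerPoly]
  | one => exact ⟨monic_X_sub_C _, natDegree_X_sub_C _⟩
  | more n h₀ h₁ =>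
    have hm : ((X - C (alphaR γ μ (n + 1))) * meixnerPoly γ μ (n + 1)).Monic :=
      (monic_X_sub_C _).mul h₁.1
    have hd : ((X - C (alphaR γ μ (n + 1))) * meixnerPoly γ μ (n + 1)).natDegree = n + 2 := by
      rw [(monic_X_sub_C _).natDegree_mul h₁.1, h₁.2, natDegree_X_sub_C]
      ring
    have hlt : (C (betaR γ μ (n + 1)) * meixnerPoly γ μ n).natDegree <
        ((X - C (alphaR γ μ (n + 1))) * meixnerPoly γ μ (n + 1)).natDegree := by
      rw [hd]
      exact lt_of_le_of_lt (natDegree_C_mul_le _ _) (by omega)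
    exact ⟨hm.sub_of_left (degree_lt_degree hlt),
      (natDegree_sub_eq_left_of_natDegree_lt hlt).trans hd⟩

/-! ### The explicit formula satisfies the recurrence -/

lemma poch_zero (a : ℝ) : poch a 0 = 1 := Finset.prod_range_zero _

lemma poch_succ (a : ℝ) (k : ℕ) : poch a (k + 1) = poch a k * (a + k) :=
  Finset.prod_range_succ _ _

lemma poch_succ_left (a : ℝ) (k : ℕ) : poch a (k + 1) = a * poch (a + 1) k := by
  unfold poch
  rw [Finset.prod_range_succ']
  push_cast
  rw [add_zero, mul_comm]
  congr 1
  refine Finset.prod_congr rfl fun m _ => ?_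
  ring

lemma poch_pos {a : ℝ} (ha : 0 < a) (k : ℕ) : 0 < poch a k :=
  Finset.prod_pos fun m _ => by positivity

lemma poch_neg_natCast_eq_zero {n k : ℕ} (h : n < k) : poch (-(n : ℝ)) k = 0 :=
  Finset.prod_eq_zero (Finset.mem_range.2 h) (by simp)

/-- The coefficient of `(-x)_k` in the monic Meixner polynomial of degree `n`. -/
def meixnerCoeff (γ μ : ℝ) (n k : ℕ) : ℝ :=
  poch γ n * (μ / (μ - 1)) ^ n *
    (poch (-(n : ℝ)) k / poch γ k * (1 - μ⁻¹) ^ k / (Nat.factorial k : ℝ))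

lemma meixnerM_eq_sum {γ μ : ℝ} {n N : ℕ} (h : n < N) (x : ℝ) :
    MeixnerM γ μ n x = ∑ k ∈ Finset.range N, meixnerCoeff γ μ n k * poch (-x) k := by
  unfold MeixnerM
  rw [Finset.mul_sum]
  refine (Finset.sum_congr rfl fun k _ => ?_).trans
    (Finset.sum_subset (Finset.range_subset_range.2 h) fun k _ hk => ?_)
  · unfold meixnerCoeff
    ring
  · have : n < k := by simpa [Nat.lt_succ_iff] using hk
    simp [meixnerCoeff, poch_neg_natCast_eq_zero this]

lemma one_sub_inv_eq {μ : ℝ} (hμ0 : 0 < μ) : 1 - μ⁻¹ = (μ / (μ - 1))⁻¹ := by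
  have h0 := hμ0.ne'
  rw [inv_div]
  field_simp

lemma alphaR_eq {γ μ : ℝ} (hμ1 : μ < 1) (n : ℕ) :
    alphaR γ μ n = n * (1 - 2 * (μ / (μ - 1))) - μ / (μ - 1) * γ := by
  have h1 : μ - 1 ≠ 0 := by linarith
  have h2 : 1 - μ ≠ 0 := by linarith
  unfold alphaR
  field_simp
  ring

lemma betaR_eq {γ μ : ℝ} (hμ1 : μ < 1) (n : ℕ) :
    betaR γ μ n = n * (n + γ - 1) * (μ / (μ - 1)) * (μ / (μ - 1) - 1) := by
  have h1 : μ - 1 ≠ 0 := by linarith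
  have h2 : 1 - μ ≠ 0 := by linarith
  unfold betaR
  field_simp
  ring

lemma meixnerCoeff_recurrence_zero {γ μ : ℝ} (hμ1 : μ < 1) (n : ℕ) :
    0 = meixnerCoeff γ μ (n + 2) 0 + alphaR γ μ (n + 1) * meixnerCoeff γ μ (n + 1) 0
      + betaR γ μ (n + 1) * meixnerCoeff γ μ n 0 := by
  rw [alphaR_eq hμ1, betaR_eq hμ1]
  simp only [meixnerCoeff, poch_succ, poch_zero, pow_zero, pow_succ, Nat.factorial_zero]
  push_cast
  ring

lemma meixnerCoeff_recurrence_succ {γ μ : ℝ} (hγ : 0 < γ) (hμ0 : 0 < μ) (hμ1 : μ < 1)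
    (n k : ℕ) :
    (k + 1) * meixnerCoeff γ μ (n + 1) (k + 1) - meixnerCoeff γ μ (n + 1) k =
      meixnerCoeff γ μ (n + 2) (k + 1) + alphaR γ μ (n + 1) * meixnerCoeff γ μ (n + 1) (k + 1)
      + betaR γ μ (n + 1) * meixnerCoeff γ μ n (k + 1) := by
  have hw : μ / (μ - 1) ≠ 0 := div_ne_zero hμ0.ne' (by linarith)
  have a1 : -((n + 1 : ℕ) : ℝ) + 1 = -(n : ℝ) := by push_cast; ring
  have a2 : -((n + 2 : ℕ) : ℝ) + 1 = -((n + 1 : ℕ) : ℝ) := by push_cast; ring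
  rw [alphaR_eq hμ1, betaR_eq hμ1]
  simp only [meixnerCoeff, one_sub_inv_eq hμ0]
  generalize μ / (μ - 1) = w at hw
  rcases k with _ | k
  · simp only [poch_succ, poch_zero, pow_zero, pow_succ, Nat.factorial]
    push_cast
    field_simp
    ring
  · have hk := (poch_pos hγ k).ne'
    have hk1 : γ + k ≠ 0 := by positivity
    have hk2 : γ + (k + 1) ≠ 0 := by positivity
    have hf : (Nat.factorial k : ℝ) ≠ 0 := by positivity
    have b1 : poch (-((n + 1 : ℕ) : ℝ)) (k + 1) = -((n + 1 : ℕ) : ℝ) * poch (-(n : ℝ)) k := by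
      rw [poch_succ_left, a1]
    have b2 : poch (-((n + 2 : ℕ) : ℝ)) (k + 1 + 1) =
        -((n + 2 : ℕ) : ℝ) * (-((n + 1 : ℕ) : ℝ) * poch (-(n : ℝ)) k) := by
      rw [poch_succ_left, a2, b1]
    have b3 : poch (-((n + 1 : ℕ) : ℝ)) (k + 1 + 1) =
        -((n + 1 : ℕ) : ℝ) * (poch (-(n : ℝ)) k * (-(n : ℝ) + k)) := by
      rw [poch_succ_left, a1, poch_succ]
    simp only [b1, b2, b3, poch_succ, Nat.factorial_succ, inv_pow]
    generalize poch (-(n : ℝ)) k = q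
    generalize poch γ n = r
    push_cast
    field_simp
    ring

lemma mul_poch_neg (x : ℝ) (k : ℕ) : x * poch (-x) k = k * poch (-x) k - poch (-x) (k + 1) := by
  rw [poch_succ]
  ring

lemma meixnerM_recurrence {γ μ : ℝ} (hγ : 0 < γ) (hμ0 : 0 < μ) (hμ1 : μ < 1) (n : ℕ) (x : ℝ) :
    x * MeixnerM γ μ (n + 1) x = MeixnerM γ μ (n + 2) x
      + alphaR γ μ (n + 1) * MeixnerM γ μ (n + 1) x + betaR γ μ (n + 1) * MeixnerM γ μ n x := by
  have hL : x * MeixnerM γ μ (n + 1) x =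
      ∑ k ∈ Finset.range (n + 4), (k : ℝ) * meixnerCoeff γ μ (n + 1) k * poch (-x) k
      - ∑ k ∈ Finset.range (n + 3), meixnerCoeff γ μ (n + 1) k * poch (-x) (k + 1) := by
    have h0 : ∀ k ∈ Finset.range (n + 4), (k : ℝ) * meixnerCoeff γ μ (n + 1) k * poch (-x) k =
      x * (meixnerCoeff γ μ (n + 1) k * poch (-x) k)
        + meixnerCoeff γ μ (n + 1) k * poch (-x) (k + 1) := fun k _ => by
      linear_combination -meixnerCoeff γ μ (n + 1) k * mul_poch_neg x k
    rw [Finset.sum_congr rfl h0, Finset.sum_add_distrib, ← Finset.mul_sum,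
      ← meixnerM_eq_sum (by omega : n + 1 < n + 4),
      Finset.sum_range_succ (fun k => meixnerCoeff γ μ (n + 1) k * poch (-x) (k + 1))]
    have : meixnerCoeff γ μ (n + 1) (n + 3) = 0 := by
      simp only [meixnerCoeff]
      rw [poch_neg_natCast_eq_zero (by omega)]
      simp
    rw [this]
    ring
  rw [hL, meixnerM_eq_sum (by omega : n + 2 < n + 4), meixnerM_eq_sum (by omega : n + 1 < n + 4),
    meixnerM_eq_sum (by omega : n < n + 4)]
  simp only [Finset.sum_range_succ' _ (n + 3)]
  have h0 := meixnerCoeff_recurrence_zero (γ := γ) hμ1 n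
  have hs : ∑ k ∈ Finset.range (n + 3),
        ((k + 1 : ℕ) : ℝ) * meixnerCoeff γ μ (n + 1) (k + 1) * poch (-x) (k + 1)
      - ∑ k ∈ Finset.range (n + 3), meixnerCoeff γ μ (n + 1) k * poch (-x) (k + 1) =
      ∑ k ∈ Finset.range (n + 3), meixnerCoeff γ μ (n + 2) (k + 1) * poch (-x) (k + 1)
      + alphaR γ μ (n + 1) *
        ∑ k ∈ Finset.range (n + 3), meixnerCoeff γ μ (n + 1) (k + 1) * poch (-x) (k + 1)
      + betaR γ μ (n + 1) *
        ∑ k ∈ Finset.range (n + 3), meixnerCoeff γ μ n (k + 1) * poch (-x) (k + 1) := by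
    rw [Finset.mul_sum, Finset.mul_sum, ← Finset.sum_sub_distrib, ← Finset.sum_add_distrib,
      ← Finset.sum_add_distrib]
    refine Finset.sum_congr rfl fun k _ => ?_
    push_cast
    linear_combination poch (-x) (k + 1) * meixnerCoeff_recurrence_succ hγ hμ0 hμ1 n k
  push_cast at hs ⊢
  linear_combination hs + poch (-x) 0 * h0

lemma meixnerM_eq_eval {γ μ : ℝ} (hγ : 0 < γ) (hμ0 : 0 < μ) (hμ1 : μ < 1) (n : ℕ) :
    MeixnerM γ μ n = fun x => (meixnerPoly γ μ n).eval x := by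
  induction n using Nat.twoStepInduction with
  | zero =>
    funext x
    simp [MeixnerM, meixnerPoly, poch]
  | one =>
    funext x
    have hw : μ / (μ - 1) ≠ 0 := div_ne_zero hμ0.ne' (by linarith)
    simp only [MeixnerM, meixnerPoly, poch, alphaR_eq hμ1, one_sub_inv_eq hμ0,
      Finset.sum_range_succ, Finset.prod_range_succ, Finset.range_zero, Finset.sum_empty,
      Finset.prod_empty, eval_sub, eval_X, eval_C, Nat.factorial, Nat.reduceAdd]
    generalize μ / (μ - 1) = w at hw
    push_cast
    field_simp
    ring
  | more n h₀ h₁ =>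
    funext x
    have h := meixnerM_recurrence hγ hμ0 hμ1 n x
    rw [h₀, h₁] at h
    simp only [meixnerPoly, eval_sub, eval_mul, eval_X, eval_C]
    linear_combination -h

/-! ### The structure relations -/

lemma eval_meixnerPoly_succ {γ μ : ℝ} (n : ℕ) (x : ℝ) :
    (meixnerPoly γ μ (n + 2)).eval x =
      (x - alphaR γ μ (n + 1)) * (meixnerPoly γ μ (n + 1)).eval x
        - betaR γ μ (n + 1) * (meixnerPoly γ μ n).eval x := by
  simp [meixnerPoly]

lemma meixnerPoly_backward {γ μ : ℝ} (hμ1 : μ < 1) (n : ℕ) (x : ℝ) :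
    x * ((meixnerPoly γ μ (n + 1)).eval x - (meixnerPoly γ μ (n + 1)).eval (x - 1)) =
      (n + 1 : ℕ) * (meixnerPoly γ μ (n + 1)).eval x
        + (1 - μ) * betaR γ μ (n + 1) * (meixnerPoly γ μ n).eval x := by
  have h2 : 1 - μ ≠ 0 := by linarith
  induction n using Nat.twoStepInduction with
  | zero =>
    simp [meixnerPoly, alphaR, betaR]
    field_simp
    ring
  | one =>
    simp [meixnerPoly, alphaR, betaR]
    field_simp
    ring
  | more n h₀ h₁ =>
    have r1 := eval_meixnerPoly_succ (γ := γ) (μ := μ) (n + 1)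
    have r0 := eval_meixnerPoly_succ (γ := γ) (μ := μ) n x
    rw [show n + 2 + 1 = n + 1 + 2 by ring, r1 x, r1 (x - 1)]
    simp only [show n + 1 + 1 = n + 2 by ring] at *
    generalize (meixnerPoly γ μ (n + 2)).eval x = p2 at *
    generalize (meixnerPoly γ μ (n + 2)).eval (x - 1) = q2 at *
    generalize (meixnerPoly γ μ (n + 1)).eval x = p1 at *
    generalize (meixnerPoly γ μ (n + 1)).eval (x - 1) = q1 at *
    generalize (meixnerPoly γ μ n).eval x = p0 at *
    have key : x * (((x - alphaR γ μ (n + 2)) * p2 - betaR γ μ (n + 2) * p1)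
        - ((x - 1 - alphaR γ μ (n + 2)) * q2 - betaR γ μ (n + 2) * q1))
        - ((n + 1 + 2 : ℕ) * ((x - alphaR γ μ (n + 2)) * p2 - betaR γ μ (n + 2) * p1)
          + (1 - μ) * betaR γ μ (n + 1 + 2) * p2) = 0 := by
      have t : x * q2 = x * p2 - ((n + 2 : ℕ) * p2 + (1 - μ) * betaR γ μ (n + 2) * p1) := by
        linear_combination -h₁
      have t' : x * q1 = x * p1 - ((n + 1 : ℕ) * p1
          + (1 - μ) * ((x - alphaR γ μ (n + 1)) * p1 - p2)) := by
        linear_combination -h₀ - (1 - μ) * r0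
      have : x * (((x - alphaR γ μ (n + 2)) * p2 - betaR γ μ (n + 2) * p1)
        - ((x - 1 - alphaR γ μ (n + 2)) * q2 - betaR γ μ (n + 2) * q1)) =
        ((x - alphaR γ μ (n + 2)) * (x * p2) - betaR γ μ (n + 2) * (x * p1))
        - ((x - 1 - alphaR γ μ (n + 2)) * (x * q2) - betaR γ μ (n + 2) * (x * q1)) := by ring
      rw [this, t, t']
      simp only [alphaR, betaR]
      push_cast
      field_simp
      ring
    linear_combination key

lemma meixnerPoly_forward {γ μ : ℝ} (hμ0 : 0 < μ) (hμ1 : μ < 1) (n : ℕ) (x : ℝ) :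
    (x + γ) * ((meixnerPoly γ μ (n + 1)).eval (x + 1) - (meixnerPoly γ μ (n + 1)).eval x) =
      (n + 1 : ℕ) * (meixnerPoly γ μ (n + 1)).eval x
        + (1 - μ) / μ * betaR γ μ (n + 1) * (meixnerPoly γ μ n).eval x := by
  have h2 : 1 - μ ≠ 0 := by linarith
  have h0 := hμ0.ne'
  induction n using Nat.twoStepInduction with
  | zero =>
    simp [meixnerPoly, alphaR, betaR]
    field_simp
    ring
  | one =>
    simp [meixnerPoly, alphaR, betaR]
    field_simp
    ring
  | more n h₀ h₁ =>
    have r1 := eval_meixnerPoly_succ (γ := γ) (μ := μ) (n + 1)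
    have r0 := eval_meixnerPoly_succ (γ := γ) (μ := μ) n x
    rw [show n + 2 + 1 = n + 1 + 2 by ring, r1 x, r1 (x + 1)]
    simp only [show n + 1 + 1 = n + 2 by ring] at *
    generalize (meixnerPoly γ μ (n + 2)).eval x = p2 at *
    generalize (meixnerPoly γ μ (n + 2)).eval (x + 1) = q2 at *
    generalize (meixnerPoly γ μ (n + 1)).eval x = p1 at *
    generalize (meixnerPoly γ μ (n + 1)).eval (x + 1) = q1 at *
    generalize (meixnerPoly γ μ n).eval x = p0 at *
    have key : (x + γ) * (((x + 1 - alphaR γ μ (n + 2)) * q2 - betaR γ μ (n + 2) * q1)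
        - ((x - alphaR γ μ (n + 2)) * p2 - betaR γ μ (n + 2) * p1))
        - ((n + 1 + 2 : ℕ) * ((x - alphaR γ μ (n + 2)) * p2 - betaR γ μ (n + 2) * p1)
          + (1 - μ) / μ * betaR γ μ (n + 1 + 2) * p2) = 0 := by
      have t : (x + γ) * q2 = (x + γ) * p2
          + ((n + 2 : ℕ) * p2 + (1 - μ) / μ * betaR γ μ (n + 2) * p1) := by
        linear_combination h₁
      have t' : (x + γ) * q1 = (x + γ) * p1 + ((n + 1 : ℕ) * p1
          + (1 - μ) / μ * ((x - alphaR γ μ (n + 1)) * p1 - p2)) := by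
        linear_combination h₀ + (1 - μ) / μ * r0
      have : (x + γ) * (((x + 1 - alphaR γ μ (n + 2)) * q2 - betaR γ μ (n + 2) * q1)
        - ((x - alphaR γ μ (n + 2)) * p2 - betaR γ μ (n + 2) * p1)) =
        ((x + 1 - alphaR γ μ (n + 2)) * ((x + γ) * q2) - betaR γ μ (n + 2) * ((x + γ) * q1))
        - ((x - alphaR γ μ (n + 2)) * ((x + γ) * p2) - betaR γ μ (n + 2) * ((x + γ) * p1)) := by
          ring
      rw [this, t, t']
      simp only [alphaR, betaR]
      push_cast
      field_simp
      ring
    linear_combination key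

/-! ### The Meixner functional -/

lemma summable_pow_mul_meixnerWeight {γ μ : ℝ} (hγ : 0 < γ) (hμ0 : 0 < μ) (hμ1 : μ < 1)
    (m : ℕ) :
    Summable fun x : ℕ => ((x : ℝ) + 1) ^ m * (μ ^ x * poch γ x / (Nat.factorial x : ℝ)) := by
  refine summable_of_ratio_test_tendsto_lt_one hμ1 (Eventually.of_forall fun x => ?_) ?_
  · have := poch_pos hγ x
    positivity
  · have h1 : Tendsto (fun x : ℕ => (1 + 1 / ((x : ℝ) + 1)) ^ m
        * (μ * (1 + (γ - 1) * (1 / ((x : ℝ) + 1))))) atTop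
        (𝓝 ((1 + 0) ^ m * (μ * (1 + (γ - 1) * 0)))) := by
      have h := tendsto_one_div_add_atTop_nhds_zero_nat (𝕜 := ℝ)
      exact ((h.const_add 1).pow m).mul (((h.const_mul _).const_add 1).const_mul _)
    simp only [add_zero, one_pow, mul_zero, mul_one, one_mul] at h1
    refine h1.congr fun x => ?_
    have hp := poch_pos hγ x
    have hp' := poch_pos hγ (x + 1)
    rw [Real.norm_of_nonneg (by positivity), Real.norm_of_nonneg (by positivity), poch_succ,
      Nat.factorial_succ]
    have e : 1 + 1 / ((x : ℝ) + 1) = ((x : ℝ) + 1 + 1) / (x + 1) := by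
      field_simp
    rw [e, div_pow]
    push_cast
    field_simp
    ring

lemma summable_eval_mul_meixnerWeight {γ μ : ℝ} (hγ : 0 < γ) (hμ0 : 0 < μ) (hμ1 : μ < 1)
    (p : ℝ[X]) :
    Summable fun x : ℕ => p.eval (x : ℝ) * (μ ^ x * poch γ x / (Nat.factorial x : ℝ)) := by
  induction p using Polynomial.induction_on' with
  | add p q hp hq => simpa [add_mul] using hp.add hq
  | monomial m a =>
    refine ((summable_pow_mul_meixnerWeight hγ hμ0 hμ1 m).mul_left |a|).of_norm_bounded fun x => ?_
    have hp := poch_pos hγ x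
    have hw : 0 ≤ μ ^ x * poch γ x / (Nat.factorial x : ℝ) := by positivity
    rw [eval_monomial, norm_mul, norm_mul, Real.norm_of_nonneg hw, Real.norm_eq_abs,
      Real.norm_of_nonneg (by positivity : (0 : ℝ) ≤ (x : ℝ) ^ m), mul_assoc]
    gcongr
    linarith

/-- The Meixner functional, with the Pearson equation satisfied by its weight. -/
lemma exists_meixnerFunctional {γ μ : ℝ} (hγ : 0 < γ) (hμ0 : 0 < μ) (hμ1 : μ < 1) :
    ∃ L : ℝ[X] →ₗ[ℝ] ℝ,
      (∀ p q : ℝ[X], mIP γ μ (fun x => p.eval x) (fun x => q.eval x) = L (p * q)) ∧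
      0 < L 1 ∧ ∀ p : ℝ[X], L (X * p.comp (X - 1)) = μ * L ((X + C γ) * p) := by
  have hs := summable_eval_mul_meixnerWeight hγ hμ0 hμ1
  refine ⟨{ toFun := fun p =>
              ∑' x : ℕ, p.eval (x : ℝ) * (μ ^ x * poch γ x / (Nat.factorial x : ℝ))
            map_add' := fun p q => ?_
            map_smul' := fun c p => ?_ }, fun p q => ?_, ?_, fun p => ?_⟩
  · simp only [eval_add, add_mul]
    exact (hs p).tsum_add (hs q)
  · simp only [eval_smul, smul_eq_mul, mul_assoc, RingHom.id_apply]
    exact tsum_mul_left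
  · simp only [mIP, LinearMap.coe_mk, AddHom.coe_mk, eval_mul]
    refine tsum_congr fun x => ?_
    ring
  · have hpos : ∀ x : ℕ, 0 < (1 : ℝ[X]).eval (x : ℝ)
        * (μ ^ x * poch γ x / (Nat.factorial x : ℝ)) := fun x => by
      have hp := poch_pos hγ x
      rw [eval_one]
      positivity
    exact (hs 1).tsum_pos (fun x => (hpos x).le) 0 (hpos 0)
  · simp only [LinearMap.coe_mk, AddHom.coe_mk]
    rw [(hs (X * p.comp (X - 1))).tsum_eq_zero_add, ← tsum_mul_left]
    simp only [eval_mul, eval_X, eval_comp, eval_sub, eval_one, eval_add, eval_C, Nat.cast_zero,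
      zero_mul, zero_add]
    refine tsum_congr fun x => ?_
    rw [poch_succ, Nat.factorial_succ]
    push_cast
    rw [add_sub_cancel_right]
    field_simp
    ring

section Functional

variable {γ μ : ℝ} {L : ℝ[X] →ₗ[ℝ] ℝ}

lemma functional_C_mul (c : ℝ) (p : ℝ[X]) : L (C c * p) = c * L p := by
  rw [← smul_eq_C_mul, map_smul, smul_eq_mul]

lemma functional_meixnerPoly_succ (hμ1 : μ < 1)
    (hL : ∀ p : ℝ[X], L (X * p.comp (X - 1)) = μ * L ((X + C γ) * p)) (n : ℕ) :
    L (meixnerPoly γ μ (n + 1)) = 0 := by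
  have h2 : 1 - μ ≠ 0 := by linarith
  induction n with
  | zero =>
    have h := hL 1
    have e : meixnerPoly γ μ (0 + 1) = X - C (alphaR γ μ 0) * 1 := by simp [meixnerPoly]
    rw [e, map_sub, functional_C_mul]
    rw [one_comp, add_mul, map_add, functional_C_mul, mul_one] at h
    simp only [alphaR]
    field_simp
    push_cast
    linear_combination h
  | succ n ih =>
    set P := meixnerPoly γ μ
    have hP := hL (P (n + 1))
    have hb : X * (P (n + 1)).comp (X - 1) = X * P (n + 1) - (C ((n + 1 : ℕ) : ℝ) * P (n + 1)
        + C ((1 - μ) * betaR γ μ (n + 1)) * P n) := by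
      refine Polynomial.funext fun x => ?_
      have := meixnerPoly_backward (γ := γ) hμ1 n x
      simp only [eval_mul, eval_X, eval_comp, eval_sub, eval_one, eval_add, eval_C, P]
      linear_combination -this
    have hX := X_mul_meixnerPoly_succ γ μ n
    change X * P (n + 1) = P (n + 2) + _ * P (n + 1) + _ * P n at hX
    rw [hb, add_mul, hX] at hP
    simp only [map_sub, map_add, functional_C_mul, ih] at hP
    have : (1 - μ) * L (P (n + 2)) = 0 := by linear_combination hP
    exact (mul_eq_zero.1 this).resolve_left h2

lemma functional_meixnerPoly_mul_of_lt (hL : ∀ n, L (meixnerPoly γ μ (n + 1)) = 0) (m : ℕ) :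
    ∀ n, m < n → L (meixnerPoly γ μ n * meixnerPoly γ μ m) = 0 := by
  set P := meixnerPoly γ μ
  induction m using Nat.twoStepInduction with
  | zero =>
    rintro (_ | n) hn
    · omega
    · simpa [P, meixnerPoly] using hL n
  | one =>
    rintro (_ | _ | n) hn
    · omega
    · omega
    · have hX := X_mul_meixnerPoly_succ γ μ (n + 1)
      have : P (n + 1 + 1) * P 1 = P (n + 3) + C (alphaR γ μ (n + 2)) * P (n + 2)
          + C (betaR γ μ (n + 2)) * P (n + 1) - C (alphaR γ μ 0) * P (n + 2) := by
        simp only [P, meixnerPoly] at hX ⊢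
        linear_combination hX
      rw [this]
      simp only [map_sub, map_add, functional_C_mul, P, hL]
      ring
  | more m h₀ h₁ =>
    rintro (_ | n) hn
    · omega
    · have hX := X_mul_meixnerPoly_succ γ μ n
      have hM := X_mul_meixnerPoly_succ γ μ m
      have : P (n + 1) * P (m + 2) = P (n + 2) * P (m + 1)
          + C (alphaR γ μ (n + 1)) * (P (n + 1) * P (m + 1))
          + C (betaR γ μ (n + 1)) * (P n * P (m + 1))
          - C (alphaR γ μ (m + 1)) * (P (n + 1) * P (m + 1))
          - C (betaR γ μ (m + 1)) * (P (n + 1) * P m) := by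
        simp only [P]
        linear_combination meixnerPoly γ μ (m + 1) * hX - meixnerPoly γ μ (n + 1) * hM
      rw [this]
      simp only [map_sub, map_add, functional_C_mul]
      rw [h₁ (n + 2) (by omega), h₁ (n + 1) (by omega), h₁ n (by omega), h₀ (n + 1) (by omega)]
      ring

lemma functional_meixnerPoly_sq_succ (hL : ∀ n, L (meixnerPoly γ μ (n + 1)) = 0) (n : ℕ) :
    L (meixnerPoly γ μ (n + 1) * meixnerPoly γ μ (n + 1)) =
      betaR γ μ (n + 1) * L (meixnerPoly γ μ n * meixnerPoly γ μ n) := by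
  have ho := functional_meixnerPoly_mul_of_lt hL
  have hX := X_mul_meixnerPoly_succ γ μ n
  rcases n with _ | n
  · have hM := X_mul_meixnerPoly_zero γ μ
    have := congrArg L (show meixnerPoly γ μ 1 * meixnerPoly γ μ 1 =
      meixnerPoly γ μ 2 * meixnerPoly γ μ 0
      + C (alphaR γ μ 1) * (meixnerPoly γ μ 1 * meixnerPoly γ μ 0)
      + C (betaR γ μ 1) * (meixnerPoly γ μ 0 * meixnerPoly γ μ 0)
      - C (alphaR γ μ 0) * (meixnerPoly γ μ 1 * meixnerPoly γ μ 0) by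
        linear_combination meixnerPoly γ μ 0 * hX - meixnerPoly γ μ 1 * hM)
    simp only [map_sub, map_add, functional_C_mul] at this
    rw [ho 0 1 (by omega), ho 0 2 (by omega)] at this
    simpa using this
  · have hM := X_mul_meixnerPoly_succ γ μ n
    have := congrArg L (show meixnerPoly γ μ (n + 2) * meixnerPoly γ μ (n + 2) =
      meixnerPoly γ μ (n + 3) * meixnerPoly γ μ (n + 1)
      + C (alphaR γ μ (n + 2)) * (meixnerPoly γ μ (n + 2) * meixnerPoly γ μ (n + 1))
      + C (betaR γ μ (n + 2)) * (meixnerPoly γ μ (n + 1) * meixnerPoly γ μ (n + 1))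
      - C (alphaR γ μ (n + 1)) * (meixnerPoly γ μ (n + 2) * meixnerPoly γ μ (n + 1))
      - C (betaR γ μ (n + 1)) * (meixnerPoly γ μ (n + 2) * meixnerPoly γ μ n) by
        linear_combination meixnerPoly γ μ (n + 1) * hX - meixnerPoly γ μ (n + 2) * hM)
    simp only [map_sub, map_add, functional_C_mul] at this
    rw [ho (n + 1) (n + 2) (by omega), ho (n + 1) (n + 3) (by omega),
      ho n (n + 2) (by omega)] at this
    simpa using this

end Functional

lemma exists_eq_sum_meixnerPoly (γ μ : ℝ) (n : ℕ) (p : ℝ[X]) (hp : p.degree < n) :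
    ∃ c : ℕ → ℝ, p = ∑ k ∈ Finset.range n, C (c k) * meixnerPoly γ μ k := by
  induction n generalizing p with
  | zero => exact ⟨0, by simpa using hp⟩
  | succ n ih =>
    obtain ⟨hm, hd⟩ := monic_natDegree_meixnerPoly γ μ n
    have hlt : (p - C (p.coeff n) * meixnerPoly γ μ n).degree < n := by
      rw [degree_lt_iff_coeff_zero] at hp ⊢
      intro k hk
      rw [coeff_sub, coeff_C_mul]
      rcases hk.eq_or_lt with rfl | hk
      · have : (meixnerPoly γ μ n).coeff n = 1 := by
          simpa [leadingCoeff, hd] using hm.leadingCoeff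
        rw [this]
        ring
      · rw [hp k hk, coeff_eq_zero_of_natDegree_lt (hd.trans_lt hk)]
        ring
    obtain ⟨c, hc⟩ := ih _ hlt
    refine ⟨fun k => if k = n then p.coeff n else c k, ?_⟩
    simp only [Finset.sum_range_succ, if_true]
    rw [← sub_eq_iff_eq_add, hc]
    refine Finset.sum_congr rfl fun k hk => ?_
    rw [if_neg (Finset.mem_range.1 hk).ne]

/-! ### Norms and kernels -/

lemma betaR_succ_pos {γ μ : ℝ} (hγ : 0 < γ) (hμ0 : 0 < μ) (hμ1 : μ < 1) (n : ℕ) :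
    0 < betaR γ μ (n + 1) := by
  have h1 : 0 < 1 - μ := by linarith
  have h2 : (0 : ℝ) < ((n + 1 : ℕ) : ℝ) + γ - 1 := by
    push_cast
    linarith [n.cast_nonneg (α := ℝ)]
  unfold betaR
  positivity

lemma nrm2_pos_and_succ {γ μ : ℝ} (hγ : 0 < γ) (hμ0 : 0 < μ) (hμ1 : μ < 1) (n : ℕ) :
    0 < nrm2 γ μ n ∧ nrm2 γ μ (n + 1) = betaR γ μ (n + 1) * nrm2 γ μ n := by
  obtain ⟨L, hL, h1, hP⟩ := exists_meixnerFunctional hγ hμ0 hμ1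
  have hz := functional_meixnerPoly_succ hμ1 hP
  have hn : ∀ k, nrm2 γ μ k = L (meixnerPoly γ μ k * meixnerPoly γ μ k) := fun k => by
    rw [nrm2, meixnerM_eq_eval hγ hμ0 hμ1, hL]
  have hs : ∀ k, nrm2 γ μ (k + 1) = betaR γ μ (k + 1) * nrm2 γ μ k := fun k => by
    rw [hn, hn, functional_meixnerPoly_sq_succ hz]
  refine ⟨?_, hs n⟩
  induction n with
  | zero => simpa [hn, meixnerPoly] using h1
  | succ n ih =>
    have hb := betaR_succ_pos hγ hμ0 hμ1 n
    rw [hs]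
    positivity

lemma christoffel_darboux {γ μ : ℝ} (hγ : 0 < γ) (hμ0 : 0 < μ) (hμ1 : μ < 1) (n : ℕ)
    (x y : ℝ) :
    (x - y) * ∑ k ∈ Finset.range (n + 1),
        MeixnerM γ μ k x * MeixnerM γ μ k y / nrm2 γ μ k =
      (MeixnerM γ μ (n + 1) x * MeixnerM γ μ n y
        - MeixnerM γ μ n x * MeixnerM γ μ (n + 1) y) / nrm2 γ μ n := by
  have hN := nrm2_pos_and_succ hγ hμ0 hμ1
  induction n with
  | zero =>
    simp [meixnerM_eq_eval hγ hμ0 hμ1, meixnerPoly]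
    ring
  | succ n ih =>
    rw [Finset.sum_range_succ, mul_add, ih]
    have h0 := (hN n).1.ne'
    have h1 := (hN (n + 1)).1.ne'
    have hb : betaR γ μ (n + 1) ≠ 0 := fun h => h1 (by rw [(hN n).2, h, zero_mul])
    have rx := meixnerM_recurrence hγ hμ0 hμ1 n x
    have ry := meixnerM_recurrence hγ hμ0 hμ1 n y
    rw [(hN n).2]
    field_simp
    linear_combination MeixnerM γ μ (n + 1) y * rx - MeixnerM γ μ (n + 1) x * ry

/-! ### Difference operators -/

/-- Both difference operators have the form `s (f (x + s) - f x)` with `s = ± 1`. -/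
lemma exists_sign {i : ℕ} (hi : i = 1 ∨ i = 2) : ∃ s : ℝ, s * s = 1 ∧
    (∀ f x, Dop i f x = s * (f (x + s) - f x)) ∧ (∀ x, sh i x = x + s) ∧
    ∀ x k, br i x (k + 1) = br i x k * (x - s * k) := by
  rcases hi with rfl | rfl
  · refine ⟨1, by norm_num, fun f x => by simp [Dop], fun x => by simp [sh], fun x k => ?_⟩
    simp [br, fall, Finset.prod_range_succ]
  · refine ⟨-1, by norm_num, fun f x => by simp [Dop, sub_eq_add_neg],
      fun x => by simp [sh, sub_eq_add_neg], fun x k => ?_⟩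
    simp [br, poch, Finset.prod_range_succ]

lemma Dk_succ (i k : ℕ) (f : ℝ → ℝ) : Dk i (k + 1) f = Dop i (Dk i k f) :=
  Function.iterate_succ_apply' _ _ _

/-- `Dop i` as a linear map. -/
def DopLin (i : ℕ) : (ℝ → ℝ) →ₗ[ℝ] (ℝ → ℝ) where
  toFun := Dop i
  map_add' f g := by
    funext x
    simp only [Dop, Pi.add_apply]
    split_ifs <;> ring
  map_smul' c f := by
    funext x
    simp only [Dop, Pi.smul_apply, smul_eq_mul, RingHom.id_apply]
    split_ifs <;> ring

lemma Dk_eq_pow (i k : ℕ) (f : ℝ → ℝ) : Dk i k f = (DopLin i ^ k) f := by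
  rw [Module.End.pow_apply]
  rfl

lemma Dk_sub (i k : ℕ) (f g : ℝ → ℝ) (x : ℝ) :
    Dk i k (fun y => f y - g y) x = Dk i k f x - Dk i k g x := by
  have : (fun y => f y - g y) = f - g := rfl
  rw [this]
  simp [Dk_eq_pow]

lemma Dk_const_mul (i k : ℕ) (c : ℝ) (f : ℝ → ℝ) (x : ℝ) :
    Dk i k (fun y => c * f y) x = c * Dk i k f x := by
  have : (fun y => c * f y) = c • f := rfl
  rw [this]
  simp [Dk_eq_pow]

lemma Dk_sum (i k : ℕ) (s : Finset ℕ) (f : ℕ → ℝ → ℝ) (x : ℝ) :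
    Dk i k (fun y => ∑ m ∈ s, f m y) x = ∑ m ∈ s, Dk i k (f m) x := by
  have : (fun y => ∑ m ∈ s, f m y) = ∑ m ∈ s, f m := by
    funext y
    simp
  rw [this, Dk_eq_pow, map_sum, Finset.sum_apply]
  simp [Dk_eq_pow]

lemma Dk_linear_mul {i : ℕ} {s : ℝ} (hs : s * s = 1)
    (hD : ∀ f x, Dop i f x = s * (f (x + s) - f x)) (x : ℝ) (H : ℝ → ℝ) (k : ℕ) (y : ℝ) :
    Dk i (k + 1) (fun t => (x - t) * H t) y =
      (x - y - s * (k + 1)) * Dk i (k + 1) H y - (k + 1) * Dk i k H y := by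
  induction k generalizing y with
  | zero =>
    have e (f : ℝ → ℝ) : Dk i (0 + 1) f y = s * (f (y + s) - f y) := hD f y
    have e0 : Dk i 0 H y = H y := rfl
    rw [e, e, e0]
    push_cast
    linear_combination -H y * hs
  | succ k ih =>
    have e1 := Dk_succ i k H
    have e2 := Dk_succ i (k + 1) H
    rw [Dk_succ, hD, ih, ih, e2, hD]
    have a := congrFun e1 y
    rw [hD] at a
    set u := Dk i k H y
    set v := Dk i k H (y + s)
    have b : v - u = s * Dk i (k + 1) H y := by linear_combination -s * a - (v - u) * hs
    push_cast
    linear_combination -s * (k + 1) * b - (k + 2) * Dk i (k + 1) H y * hs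

lemma sum_Dk_linear_mul {i : ℕ} {s : ℝ} (hs : s * s = 1)
    (hD : ∀ f x, Dop i f x = s * (f (x + s) - f x))
    (hbr : ∀ x k, br i x (k + 1) = br i x k * (x - s * k)) (x α : ℝ) (H : ℝ → ℝ) (j : ℕ) :
    (j.factorial : ℝ) * ∑ k ∈ Finset.range (j + 1),
        Dk i k (fun t => (x - t) * H t) α * br i (x - α) k / (k.factorial : ℝ) =
      br i (x - α) (j + 1) * Dk i j H α := by
  induction j with
  | zero =>
    have : br i (x - α) 0 = 1 := by simp [br, fall, poch]
    simp [hbr, this, Dk]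
  | succ j ih =>
    rw [Finset.sum_range_succ, Nat.factorial_succ, Dk_linear_mul hs hD, hbr _ (j + 1), mul_add]
    have hf : (j.factorial : ℝ) ≠ 0 := by positivity
    push_cast
    rw [mul_assoc, ih]
    field_simp
    ring

/-! ### The connection formula -/

/-- Expansion of the Sobolev polynomial in Meixner polynomials. -/
lemma IsSobolevOP.eval_eq_sum {γ μ lam α : ℝ} (hγ : 0 < γ) (hμ0 : 0 < μ) (hμ1 : μ < 1)
    {i j n : ℕ} {Q : ℝ[X]} (hQ : IsSobolevOP γ μ lam α i j n Q) (x : ℝ) :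
    Q.eval x = MeixnerM γ μ n x - lam * Dk i j (fun t => Q.eval t) α *
      ∑ k ∈ Finset.range n,
        Dk i j (MeixnerM γ μ k) α / nrm2 γ μ k * MeixnerM γ μ k x := by
  obtain ⟨L, hL, -, hP⟩ := exists_meixnerFunctional hγ hμ0 hμ1
  have ho := functional_meixnerPoly_mul_of_lt (functional_meixnerPoly_succ hμ1 hP)
  have hM := meixnerM_eq_eval hγ hμ0 hμ1
  obtain ⟨hmon, hdeg, horth⟩ := hQ
  obtain ⟨hPm, hPd⟩ := monic_natDegree_meixnerPoly γ μ n
  have hlt : (Q - meixnerPoly γ μ n).degree < n := by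
    have hd : Q.degree = (meixnerPoly γ μ n).degree := by
      rw [degree_eq_natDegree hmon.ne_zero, degree_eq_natDegree hPm.ne_zero, hdeg, hPd]
    have h := degree_sub_lt_left hd hmon.ne_zero (hmon.leadingCoeff.trans hPm.leadingCoeff.symm)
    rwa [degree_eq_natDegree hmon.ne_zero, hdeg] at h
  obtain ⟨c, hc⟩ := exists_eq_sum_meixnerPoly γ μ n _ hlt
  have hQe : Q = meixnerPoly γ μ n + ∑ k ∈ Finset.range n, C (c k) * meixnerPoly γ μ k := by
    rw [← hc]
    ring
  have hck : ∀ k ∈ Finset.range n,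
      c k = -(lam * Dk i j (fun t => Q.eval t) α * Dk i j (MeixnerM γ μ k) α) / nrm2 γ μ k := by
    intro k hk
    have hkn := Finset.mem_range.1 hk
    obtain ⟨hkm, hkd⟩ := monic_natDegree_meixnerPoly γ μ k
    have h := horth (meixnerPoly γ μ k) (by
      rw [degree_eq_natDegree hkm.ne_zero, hkd]
      exact_mod_cast hkn)
    rw [sIP, hL, ← hM k] at h
    have hLk : L (Q * meixnerPoly γ μ k) = c k * nrm2 γ μ k := by
      conv_lhs => rw [hQe]
      rw [add_mul, map_add, ho k n hkn, zero_add, Finset.sum_mul, map_sum,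
        Finset.sum_eq_single_of_mem k hk, mul_assoc, functional_C_mul, nrm2, hM, hL]
      intro m _ hmk
      rw [mul_assoc, functional_C_mul]
      rcases hmk.lt_or_gt with h | h
      · rw [mul_comm (meixnerPoly γ μ m), ho m k h, mul_zero]
      · rw [ho k m h, mul_zero]
    rw [hLk] at h
    rw [eq_div_iff (nrm2_pos_and_succ hγ hμ0 hμ1 k).1.ne']
    linear_combination h
  have hQx := congrArg (eval x) hQe
  rw [hQx, eval_add, eval_finsetSum, hM, sub_eq_add_neg, ← neg_mul, Finset.mul_sum]
  congr 1
  refine Finset.sum_congr rfl fun k hk => ?_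
  rw [eval_mul, eval_C, hck k hk, hM]
  ring

/-- The connection formula `Q_n = A_{1,n} M_n + B_{1,n} M_{n-1}`. -/
lemma IsSobolevOP.eval_eq {γ μ lam α : ℝ} (hγ : 0 < γ) (hμ0 : 0 < μ) (hμ1 : μ < 1)
    (hlam : 0 < lam) {i j n : ℕ} (hi : i = 1 ∨ i = 2) {Q : ℝ[X]}
    (hQ : IsSobolevOP γ μ lam α i j (n + 1) Q) {x : ℝ} (hx : br i (x - α) (j + 1) ≠ 0) :
    Q.eval x = A1 γ μ lam α i j (n + 1) x * MeixnerM γ μ (n + 1) x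
      + B1 γ μ lam α i j (n + 1) x * MeixnerM γ μ n x := by
  obtain ⟨s, hs, hD, -, hbr⟩ := exists_sign hi
  have hN := fun k => (nrm2_pos_and_succ hγ hμ0 hμ1 k).1
  have hK : 0 < 1 + lam * Klm γ μ i j j n α α := by
    have : 0 ≤ Klm γ μ i j j n α α :=
      Finset.sum_nonneg fun k _ => div_nonneg (mul_self_nonneg _) (hN k).le
    positivity
  have hexp := hQ.eval_eq_sum hγ hμ0 hμ1
  set q := Dk i j (fun t => Q.eval t) α with hq
  have hqK : q * (1 + lam * Klm γ μ i j j n α α) = Dk i j (MeixnerM γ μ (n + 1)) α := by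
    have h1 : q = Dk i j (MeixnerM γ μ (n + 1)) α - lam * q * Klm γ μ i j j n α α := by
      conv_lhs => rw [hq, funext hexp]
      rw [Dk_sub, Dk_const_mul, Dk_sum, Klm]
      congr 2
      refine Finset.sum_congr rfl fun k _ => ?_
      rw [Dk_const_mul]
      ring
    linear_combination h1
  set S := ∑ k ∈ Finset.range (n + 1),
    Dk i j (MeixnerM γ μ k) α / nrm2 γ μ k * MeixnerM γ μ k x with hS
  have hcd : (j.factorial : ℝ) * ∑ k ∈ Finset.range (j + 1),
      (MeixnerM γ μ (n + 1) x / nrm2 γ μ n * Dk i k (MeixnerM γ μ n) α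
        - MeixnerM γ μ n x / nrm2 γ μ n * Dk i k (MeixnerM γ μ (n + 1)) α)
        * br i (x - α) k / (k.factorial : ℝ) = br i (x - α) (j + 1) * S := by
    have h := sum_Dk_linear_mul hs hD hbr x α (fun y => ∑ k ∈ Finset.range (n + 1),
        MeixnerM γ μ k x / nrm2 γ μ k * MeixnerM γ μ k y) j
    have hf : (fun t => (x - t) * ∑ k ∈ Finset.range (n + 1),
          MeixnerM γ μ k x / nrm2 γ μ k * MeixnerM γ μ k t) =
        fun t => MeixnerM γ μ (n + 1) x / nrm2 γ μ n * MeixnerM γ μ n t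
          - MeixnerM γ μ n x / nrm2 γ μ n * MeixnerM γ μ (n + 1) t := by
      funext t
      have h := christoffel_darboux hγ hμ0 hμ1 n x t
      simp only [div_mul_eq_mul_div]
      rw [h]
      ring
    simp only [hf, Dk_sub, Dk_const_mul, Dk_sum] at h
    rw [h, hS]
    congr 1
    refine Finset.sum_congr rfl fun k _ => ?_
    ring
  have hAB : A1 γ μ lam α i j (n + 1) x * MeixnerM γ μ (n + 1) x
      + B1 γ μ lam α i j (n + 1) x * MeixnerM γ μ n x = MeixnerM γ μ (n + 1) x
      - lam * q / br i (x - α) (j + 1) * (br i (x - α) (j + 1) * S) := by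
    have hsplit : (j.factorial : ℝ) * ∑ k ∈ Finset.range (j + 1),
      (MeixnerM γ μ (n + 1) x / nrm2 γ μ n * Dk i k (MeixnerM γ μ n) α
        - MeixnerM γ μ n x / nrm2 γ μ n * Dk i k (MeixnerM γ μ (n + 1)) α)
        * br i (x - α) k / (k.factorial : ℝ) * (lam * q) =
      -((∑ k ∈ Finset.range (j + 1), acoef γ μ lam α i j (n + 1) k * br i (x - α) k)
          * MeixnerM γ μ (n + 1) x
        + (∑ k ∈ Finset.range (j + 1), bcoef γ μ lam α i j (n + 1) k * br i (x - α) k)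
          * MeixnerM γ μ n x) := by
      rw [Finset.sum_mul, Finset.sum_mul, ← Finset.sum_add_distrib, ← Finset.sum_neg_distrib,
        Finset.mul_sum]
      refine Finset.sum_congr rfl fun k _ => ?_
      have hk : (k.factorial : ℝ) ≠ 0 := by positivity
      have hNn := (hN n).ne'
      rw [acoef, bcoef, ← hqK, Nat.add_sub_cancel]
      field_simp
      ring
    rw [← Finset.sum_mul, ← mul_assoc, hcd] at hsplit
    clear_value S q
    rw [A1, B1]
    field_simp
    linear_combination hsplit
  rw [hAB, hexp, ← hS]
  clear_value S q
  field_simp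

/-! ### Structure relations -/

lemma meixnerM_structure {γ μ : ℝ} (hγ : 0 < γ) (hμ0 : 0 < μ) (hμ1 : μ < 1) {i : ℕ}
    (hi : i = 1 ∨ i = 2) (n : ℕ) (x : ℝ) :
    (x + γ * kdelta i 1) * Dop i (MeixnerM γ μ (n + 1)) x =
      (n + 1) * MeixnerM γ μ (n + 1) x
        + (n + 1) * (n + γ) * μ ^ kdelta i 2 / (1 - μ) * MeixnerM γ μ n x := by
  have h2 : 1 - μ ≠ 0 := by linarith
  have h0 := hμ0.ne'
  rw [meixnerM_eq_eval hγ hμ0 hμ1, meixnerM_eq_eval hγ hμ0 hμ1]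
  rcases hi with rfl | rfl
  · have h := meixnerPoly_forward (γ := γ) hμ0 hμ1 n x
    simp only [kdelta, Dop, betaR] at h ⊢
    norm_num
    rw [h]
    push_cast
    field_simp
    ring
  · have h := meixnerPoly_backward (γ := γ) hμ1 n x
    simp only [kdelta, Dop, betaR] at h ⊢
    norm_num
    rw [h]
    push_cast
    field_simp
    ring

/-- The structure relation `(x + γ δ_{i,1}) 𝒟_i Q_n = C_{1,n} M_n + D_{1,n} M_{n-1}`. -/
lemma IsSobolevOP.structure_relation {γ μ lam α : ℝ} (hγ : 0 < γ) (hμ0 : 0 < μ) (hμ1 : μ < 1)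
    (hlam : 0 < lam) {i j n : ℕ} (hi : i = 1 ∨ i = 2) {Q : ℝ[X]}
    (hQ : IsSobolevOP γ μ lam α i j (n + 1) Q) {x : ℝ} (hx : br i (x - α) (j + 1) ≠ 0)
    (hx' : br i (sh i x - α) (j + 1) ≠ 0) :
    (x + γ * kdelta i 1) * Dop i (fun t => Q.eval t) x =
      C1 γ μ lam α i j (n + 1) x * MeixnerM γ μ (n + 1) x
        + D1 γ μ lam α i j (n + 1) x * MeixnerM γ μ n x := by
  obtain ⟨s, hs, hD, hsh, -⟩ := exists_sign hi
  have e1 := hQ.eval_eq hγ hμ0 hμ1 hlam hi hx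
  have e2 := hQ.eval_eq hγ hμ0 hμ1 hlam hi hx'
  have m1 := meixnerM_structure hγ hμ0 hμ1 hi n x
  have h2 : 1 - μ ≠ 0 := by linarith
  have m0 : (x + γ * kdelta i 1) * Dop i (MeixnerM γ μ n) x =
      n * MeixnerM γ μ n x + (n * (n - 1 + γ)) * μ ^ kdelta i 2 / (betaR γ μ n * (1 - μ))
        * ((x - alphaR γ μ n) * MeixnerM γ μ n x - MeixnerM γ μ (n + 1) x) := by
    rcases n with _ | n
    · simp [hD, meixnerM_eq_eval hγ hμ0 hμ1, meixnerPoly]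
    · have hb := (betaR_succ_pos hγ hμ0 hμ1 n).ne'
      have hr := meixnerM_recurrence hγ hμ0 hμ1 n x
      have : (x - alphaR γ μ (n + 1)) * MeixnerM γ μ (n + 1) x - MeixnerM γ μ (n + 1 + 1) x =
          betaR γ μ (n + 1) * MeixnerM γ μ n x := by linear_combination hr
      rw [this, meixnerM_structure hγ hμ0 hμ1 hi n x]
      push_cast
      field_simp
      ring
  simp only [C1, D1, hD, Nat.add_sub_cancel] at m0 m1 ⊢
  rw [hsh] at e2 ⊢
  rw [e1, e2]
  push_cast
  linear_combination A1 γ μ lam α i j (n + 1) (x + s) * m1 + B1 γ μ lam α i j (n + 1) (x + s) * m0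

/-- the creation (raising) operator relation. -/
theorem sobolev_raising_operator (γ μ lam α : ℝ) (hγ : 0 < γ) (hμ0 : 0 < μ)
    (hμ1 : μ < 1) (hlam : 0 < lam) (hα : α ≤ 0) (j i n : ℕ) (hi : i = 1 ∨ i = 2)
    (hn : 2 ≤ n) (Qn Qm : Polynomial ℝ) (hQn : IsSobolevOP γ μ lam α i j n Qn)
    (hQm : IsSobolevOP γ μ lam α i j (n - 1) Qm) (x : ℝ)
    (hbr : br i (x - α) (j + 1) ≠ 0) (hbr' : br i (sh i x - α) (j + 1) ≠ 0) :
    Thetatil γ μ lam α i j n x * Dop i (fun t => Qm.eval t) x +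
        Lam γ μ lam α i j n 1 2 x * Qm.eval x =
      Lam γ μ lam α i j n 2 2 x * Qn.eval x := by
  obtain ⟨n, rfl⟩ : ∃ k, n = k + 2 := ⟨n - 2, by omega⟩
  rw [show n + 2 - 1 = n + 1 by omega] at hQm
  have q₁ := hQn.eval_eq hγ hμ0 hμ1 hlam hi hbr
  have q₂ := hQm.eval_eq hγ hμ0 hμ1 hlam hi hbr
  have st := hQm.structure_relation hγ hμ0 hμ1 hlam hi hbr hbr'
  have hr := meixnerM_recurrence hγ hμ0 hμ1 n x
  have hb := (betaR_succ_pos hγ hμ0 hμ1 n).ne'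
  have hM : MeixnerM γ μ n x = ((x - alphaR γ μ (n + 1)) * MeixnerM γ μ (n + 1) x
      - MeixnerM γ μ (n + 2) x) / betaR γ μ (n + 1) := by
    rw [eq_div_iff hb]
    linear_combination -hr
  have q₂' : Qm.eval x = A2 γ μ lam α i j (n + 2) x * MeixnerM γ μ (n + 2) x
      + B2 γ μ lam α i j (n + 2) x * MeixnerM γ μ (n + 1) x := by
    rw [q₂, hM, B2, A2, show n + 2 - 1 = n + 1 by omega]
    ring
  have st' : (x + γ * kdelta i 1) * Dop i (fun t => Qm.eval t) x =
      C2 γ μ lam α i j (n + 2) x * MeixnerM γ μ (n + 2) x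
        + D2 γ μ lam α i j (n + 2) x * MeixnerM γ μ (n + 1) x := by
    rw [st, hM, D2, C2, show n + 2 - 1 = n + 1 by omega]
    ring
  simp only [Thetatil, Theta, Lam, Aa, Bb, Cc, Dd, if_true, OfNat.ofNat_ne_one, if_false]
  rw [q₁, q₂']
  linear_combination (A1 γ μ lam α i j (n + 2) x * B2 γ μ lam α i j (n + 2) x
    - B1 γ μ lam α i j (n + 2) x * A2 γ μ lam α i j (n + 2) x) * st'
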